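/- Let a, γ, x be nonzero complex numbers with (a;q)_n ≠ 0 for all n ≥ 0. Then the big q-Bessel function, viewed as a function of its spectral parameter γ, satisfies the second-order q-difference equation (1 + 1/γ)·(J_{qγ}(x;a;q) − J_γ(x;a;q)) + (q/(a·γ))·(J_{q⁻¹γ}(x;a;q) − J_γ(x;a;q)) = −(1 + x)·J_γ(x;a;q). -/

import Mathlib

/-- The q-shifted factorial `(a;q)_n = ∏_{j=0}^{n-1} (1 - a q^j)`. -/
noncomputable def qPoch (a q : ℂ) (n : ℕ) : ℂ := ∏ j ∈ Finset.range n, (1 - a * q ^ j)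

/-- The big q-Bessel function
`J_γ(x;a;q) = ∑ (-1/x;q)_n (-1)^n q^{n(n-1)/2} / ((a;q)_n (q;q)_n) (aγx)^n`. -/
noncomputable def bigQBessel (q a γ x : ℂ) : ℂ :=
  ∑' n : ℕ, qPoch (-1 / x) q n * (-1) ^ n * q ^ (n * (n - 1) / 2) /
    (qPoch a q n * qPoch q q n) * (a * γ * x) ^ n

/-- The coefficient of `γ ^ n` in the big q-Bessel function. -/
noncomputable def bigQBesselCoeff (q a x : ℂ) (n : ℕ) : ℂ :=
  qPoch (-1 / x) q n * (-1) ^ n * q ^ (n * (n - 1) / 2) / (qPoch a q n * qPoch q q n) * (a * x) ^ n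

theorem qPoch_succ (a q : ℂ) (n : ℕ) : qPoch a q (n + 1) = qPoch a q n * (1 - a * q ^ n) :=
  Finset.prod_range_succ _ _

theorem one_sub_mul_pow_ne_zero {a q : ℂ} (h : ∀ n, qPoch a q n ≠ 0) (n : ℕ) :
    1 - a * q ^ n ≠ 0 :=
  right_ne_zero_of_mul (qPoch_succ a q n ▸ h (n + 1))

theorem qPoch_self_ne_zero {q : ℂ} (hq : ‖q‖ < 1) (n : ℕ) : qPoch q q n ≠ 0 := by
  refine Finset.prod_ne_zero_iff.2 fun j _ h => ?_
  have h1 : ‖q ^ (j + 1)‖ < 1 := by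
    rw [norm_pow]
    exact pow_lt_one₀ (norm_nonneg _) hq j.succ_ne_zero
  rw [pow_succ', ← sub_eq_zero.1 h, norm_one] at h1
  exact lt_irrefl _ h1

theorem bigQBessel_eq_tsum_coeff (q a γ x : ℂ) :
    bigQBessel q a γ x = ∑' n, bigQBesselCoeff q a x n * γ ^ n :=
  tsum_congr fun n => by
    rw [bigQBesselCoeff, show a * γ * x = a * x * γ by ring, mul_pow (a * x), ← mul_assoc]

theorem bigQBesselCoeff_succ (q a x : ℂ) (n : ℕ) :
    bigQBesselCoeff q a x (n + 1) =
      -((1 - -1 / x * q ^ n) * q ^ n * (a * x)) / ((1 - a * q ^ n) * (1 - q * q ^ n)) *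
        bigQBesselCoeff q a x n := by
  simp only [bigQBesselCoeff, qPoch_succ, Nat.triangle_succ, pow_succ, pow_add, div_eq_mul_inv,
    mul_inv]
  ring

open Filter Topology in
theorem summable_bigQBesselCoeff {q : ℂ} (hq : ‖q‖ < 1) (a γ x : ℂ) :
    Summable fun n => bigQBesselCoeff q a x n * γ ^ n := by
  have hp : Tendsto (fun n : ℕ => q ^ n) atTop (𝓝 0) := tendsto_pow_atTop_nhds_zero_of_norm_lt_one hq
  have hc : ContinuousAt (fun t : ℂ =>
      -((1 - -1 / x * t) * t * (a * x)) / ((1 - a * t) * (1 - q * t)) * γ) 0 := by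
    refine ContinuousAt.mul (ContinuousAt.div (by fun_prop) (by fun_prop) (by simp)) (by fun_prop)
  have ht := (hc.tendsto.comp hp).norm
  simp only [mul_zero, zero_mul, neg_zero, zero_div, norm_zero] at ht
  refine summable_of_ratio_norm_eventually_le (r := 1 / 2) (by norm_num) ?_
  filter_upwards [ht.eventually_le_const (show (0 : ℝ) < 1 / 2 by norm_num)] with n hn
  rw [bigQBesselCoeff_succ, pow_succ', mul_mul_mul_comm, norm_mul]
  exact mul_le_mul_of_nonneg_right hn (norm_nonneg _)

theorem hasSum_bigQBessel {q : ℂ} (hq : ‖q‖ < 1) (a γ x : ℂ) :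
    HasSum (fun n => bigQBesselCoeff q a x n * γ ^ n) (bigQBessel q a γ x) :=
  bigQBessel_eq_tsum_coeff q a γ x ▸ (summable_bigQBesselCoeff hq a γ x).hasSum

theorem bigQBessel_spectral_qDifference_eq (q : ℝ) (hq0 : 0 < q) (hq1 : q < 1)
    (a γ x : ℂ) (ha : a ≠ 0) (hγ : γ ≠ 0) (hx : x ≠ 0)
    (haP : ∀ n : ℕ, qPoch a (q : ℂ) n ≠ 0) :
    (1 + 1 / γ) *
        (bigQBessel (q : ℂ) a ((q : ℂ) * γ) x - bigQBessel (q : ℂ) a γ x) +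
      ((q : ℂ) / (a * γ)) *
        (bigQBessel (q : ℂ) a ((q : ℂ)⁻¹ * γ) x - bigQBessel (q : ℂ) a γ x) =
      -(1 + x) * bigQBessel (q : ℂ) a γ x := by
  have hq : ‖(q : ℂ)‖ < 1 := by rwa [Complex.norm_real, Real.norm_of_nonneg hq0.le]
  have hqz : (q : ℂ) ≠ 0 := Complex.ofReal_ne_zero.2 hq0.ne'
  generalize (q : ℂ) = p at *
  have hJ := hasSum_bigQBessel hq a γ x
  have hup := (hasSum_bigQBessel hq a (p * γ) x).sub hJ
  have hdown := (hasSum_bigQBessel hq a (p⁻¹ * γ) x).sub hJ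
  have hshift := (hasSum_nat_add_iff' 1).2
    ((hup.mul_left (1 / γ)).add (hdown.mul_left (p / (a * γ))))
  simp only [Finset.sum_range_one, pow_zero, sub_self, mul_zero, add_zero, sub_zero] at hshift
  rw [add_mul, one_mul, add_assoc]
  refine (hup.add hshift).unique ((hJ.mul_left (-(1 + x))).congr_fun ?_)
  intro n
  have h1 := one_sub_mul_pow_ne_zero haP n
  have h2 := one_sub_mul_pow_ne_zero (qPoch_self_ne_zero hq) n
  have h3 : p ^ n ≠ 0 := pow_ne_zero n hqz
  simp only [bigQBesselCoeff_succ, mul_pow, inv_pow, pow_succ]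
  generalize bigQBesselCoeff p a x n = c
  generalize p ^ n = t at *
  generalize hu : 1 - a * t = u at *
  generalize hv : 1 - p * t = v at *
  field_simp
  subst hu hv
  ring
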